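/- arXiv:1310.7686 — 3 statements merged into one kernel-verified Lean document; each statement's English description precedes it below -/
import Mathlib

section
/- For every real number β with 0 < β ≤ 1 and every positive integer k, there exists a unique T > 0 such that λ̃_k(β,T) = μ̃_0(β,T), i.e. (4kπ/β)·(coth(kT) − √(coth(kT)² − β)) = 8π/(Tβ). -/
open Real

/-- The hyperbolic cotangent. -/
noncomputable def coth (t : ℝ) : ℝ := Real.cosh t / Real.sinh t

/-- The normalized Steklov eigenvalues `λ̃_n(β,T)` (for `n ≥ 1`). -/
noncomputable def lamS (n : ℕ) (β T : ℝ) : ℝ :=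
  (4 * n * π / β) * (coth (n * T) - Real.sqrt ((coth (n * T)) ^ 2 - β))

/-- The normalized Steklov eigenvalues `μ̃_n(β,T)` (with `μ̃_0(β,T) = 8π/(Tβ)`). -/
noncomputable def muS (n : ℕ) (β T : ℝ) : ℝ :=
  if n = 0 then 8 * π / (T * β)
  else (4 * n * π / β) * (coth (n * T) + Real.sqrt ((coth (n * T)) ^ 2 - β))

theorem one_lt_coth {x : ℝ} (hx : 0 < x) : 1 < coth x :=
  (one_lt_div (Real.sinh_pos_iff.2 hx)).2 (Real.sinh_lt_cosh x)

theorem strictAntiOn_coth : StrictAntiOn coth (Set.Ioi 0) := by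
  intro x hx y hy hxy
  have hsx := Real.sinh_pos_iff.2 (Set.mem_Ioi.1 hx)
  have hsy := Real.sinh_pos_iff.2 (Set.mem_Ioi.1 hy)
  have hd := Real.sinh_pos_iff.2 (sub_pos.2 hxy)
  rw [Real.sinh_sub] at hd
  unfold coth
  rw [div_lt_div_iff₀ hsy hsx]
  linarith

theorem continuousOn_coth : ContinuousOn coth (Set.Ioi 0) :=
  Real.continuous_cosh.continuousOn.div Real.continuous_sinh.continuousOn
    fun _ hx => (Real.sinh_pos_iff.2 hx).ne'

theorem sub_coth_sq_pos {β x : ℝ} (hβ1 : β ≤ 1) (hx : 0 < x) : 0 < coth x ^ 2 - β := by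
  nlinarith [one_lt_coth hx]

/-- For `T > 0`, the intersection condition in terms of `x = kT`. -/
theorem lamS_eq_muS_zero_iff {β T : ℝ} {k : ℕ} (hβ : 0 < β) (hβ1 : β ≤ 1) (hk : 1 ≤ k)
    (hT : 0 < T) :
    lamS k β T = muS 0 β T ↔
      k * T * β - 2 * (coth (k * T) + √(coth (k * T) ^ 2 - β)) = 0 := by
  have hk0 : (0 : ℝ) < k := by exact_mod_cast hk
  have hx : 0 < k * T := mul_pos hk0 hT
  have hc := one_lt_coth hx
  have hr := Real.sq_sqrt (sub_coth_sq_pos hβ1 hx).le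
  have hr0 := Real.sqrt_nonneg (coth (k * T) ^ 2 - β)
  simp only [lamS, muS, if_true]
  generalize √(coth (k * T) ^ 2 - β) = r at *
  generalize coth (k * T) = c at *
  have hscale : 4 * k * π / β * (c - r) = 8 * π / (T * β) ↔ k * T * (c - r) = 2 := by
    rw [div_mul_eq_mul_div, div_eq_div_iff hβ.ne' (mul_pos hT hβ).ne']
    have hp : 4 * π * β ≠ 0 := by positivity
    constructor
    · intro h
      exact mul_left_cancel₀ hp (by linarith)
    · intro h
      linear_combination 4 * π * β * h
  rw [hscale]
  have hs : c + r ≠ 0 := by positivity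
  constructor
  · intro h
    linear_combination (c + r) * h + k * T * hr
  · intro h
    exact mul_right_cancel₀ hs (by linear_combination h - k * T * hr)

theorem strictMonoOn_mul_sub_coth_add_sqrt {β : ℝ} (hβ : 0 < β) :
    StrictMonoOn (fun x => x * β - 2 * (coth x + √(coth x ^ 2 - β))) (Set.Ioi 0) := by
  intro x hx y hy hxy
  have hc := strictAntiOn_coth hx hy hxy
  have hcy := one_lt_coth hy
  have hr : √(coth y ^ 2 - β) ≤ √(coth x ^ 2 - β) := Real.sqrt_le_sqrt (by nlinarith)
  have hm := mul_lt_mul_of_pos_right hxy hβ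
  dsimp only
  linarith

theorem exists_mul_sub_coth_add_sqrt_eq_zero {β : ℝ} (hβ : 0 < β) (hβ1 : β ≤ 1) :
    ∃ x : ℝ, 0 < x ∧ x * β - 2 * (coth x + √(coth x ^ 2 - β)) = 0 := by
  have hc1 := one_lt_coth one_pos
  set b : ℝ := 1 + 4 * coth 1 / β with hb
  have hb1 : 1 < b := by
    have : 0 < 4 * coth 1 / β := by positivity
    linarith
  have hb0 : 0 < b := one_pos.trans hb1
  have hcont : ContinuousOn (fun x => x * β - 2 * (coth x + √(coth x ^ 2 - β)))
      (Set.Icc 1 b) := by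
    have hcoth : ContinuousOn coth (Set.Icc 1 b) :=
      continuousOn_coth.mono fun x hx => one_pos.trans_le hx.1
    fun_prop
  have hleft : 1 * β - 2 * (coth 1 + √(coth 1 ^ 2 - β)) ≤ 0 := by
    linarith [Real.sqrt_nonneg (coth 1 ^ 2 - β)]
  have hright : 0 ≤ b * β - 2 * (coth b + √(coth b ^ 2 - β)) := by
    have hcb := strictAntiOn_coth (Set.mem_Ioi.2 one_pos) (Set.mem_Ioi.2 hb0) hb1
    have hr : √(coth b ^ 2 - β) ≤ coth b :=
      Real.sqrt_le_iff.2 ⟨by linarith [one_lt_coth hb0], by linarith⟩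
    have hbβ : b * β = β + 4 * coth 1 := by
      rw [hb]
      field_simp
    linarith
  obtain ⟨x, hx, hx0⟩ := intermediate_value_Icc hb1.le hcont ⟨hleft, hright⟩
  exact ⟨x, one_pos.trans_le hx.1, hx0⟩

theorem exists_unique_intersection_with_mu0 (β : ℝ) (hβ : 0 < β) (hβ1 : β ≤ 1)
    (k : ℕ) (hk : 1 ≤ k) :
    ∃! T : ℝ, 0 < T ∧ lamS k β T = muS 0 β T := by
  have hk0 : (0 : ℝ) < k := by exact_mod_cast hk
  obtain ⟨x, hx, hx0⟩ := exists_mul_sub_coth_add_sqrt_eq_zero hβ hβ1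
  have hkx : k * (x / k) = x := mul_div_cancel₀ x hk0.ne'
  refine ⟨x / k, ⟨div_pos hx hk0, ?_⟩, ?_⟩
  · rw [lamS_eq_muS_zero_iff hβ hβ1 hk (div_pos hx hk0), hkx]
    exact hx0
  · rintro T ⟨hT, h⟩
    rw [lamS_eq_muS_zero_iff hβ hβ1 hk hT] at h
    have hkT : k * T = x :=
      (strictMonoOn_mul_sub_coth_add_sqrt hβ).injOn (mul_pos hk0 hT) hx (h.trans hx0.symm)
    rw [eq_div_iff hk0.ne', mul_comm, hkT]
end

section
/- Let β be real with 0 < β ≤ 1, let l ≥ 0 and k' > k ≥ 1 be integers, and let T, T' > 0 satisfy λ̃_k(β,T) = μ̃_l(β,T) and λ̃_{k'}(β,T') = μ̃_l(β,T'). Then T' < T. (That is, the intersection time T_{k,l}(β) is strictly decreasing in k.) -/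
open Real

lemma one_lt_coth_s9 {t : ℝ} (ht : 0 < t) : 1 < coth t := by
  rw [coth, one_lt_div (Real.sinh_pos_iff.2 ht)]
  exact Real.sinh_lt_cosh t

lemma coth_le_coth {s t : ℝ} (hs : 0 < s) (hst : s ≤ t) : coth t ≤ coth s := by
  rw [coth, coth, div_le_div_iff₀ (Real.sinh_pos_iff.2 (hs.trans_le hst)) (Real.sinh_pos_iff.2 hs)]
  have h : 0 ≤ Real.sinh (t - s) := Real.sinh_nonneg_iff.2 (sub_nonneg.2 hst)
  rw [Real.sinh_sub] at h
  linarith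

lemma sub_sqrt_sq_sub_pos {β c : ℝ} (hβ : 0 < β) (hc : 0 < c) : 0 < c - √(c ^ 2 - β) :=
  sub_pos.2 ((Real.sqrt_lt' hc).2 (by linarith))

lemma sub_sqrt_sq_sub_antitone {β c d : ℝ} (hβ : 0 < β) (hc : 0 < c) (hβc : β ≤ c ^ 2)
    (hcd : c ≤ d) : d - √(d ^ 2 - β) ≤ c - √(c ^ 2 - β) := by
  have hsq : c ^ 2 ≤ d ^ 2 := by gcongr
  have hx := Real.sq_sqrt (sub_nonneg.2 hβc)
  have hy := Real.sq_sqrt (sub_nonneg.2 (hβc.trans hsq))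
  have hxc := sub_sqrt_sq_sub_pos hβ hc
  have hyd := sub_sqrt_sq_sub_pos hβ (hc.trans_le hcd)
  have hxy : √(c ^ 2 - β) ≤ √(d ^ 2 - β) := Real.sqrt_le_sqrt (by linarith)
  by_contra! hlt
  nlinarith [mul_nonneg (sub_nonneg.2 hxy) (add_pos hxc hyd).le,
    mul_pos (sub_pos.2 hlt) (add_pos hc (hc.trans_le hcd))]

/-- The factor `coth t - √(coth t ^ 2 - β)` of `lamS` is increasing in `t > 0`. -/
lemma coth_sub_sqrt_mono {β s t : ℝ} (hβ : 0 < β) (hβ1 : β ≤ 1) (hs : 0 < s) (hst : s ≤ t) :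
    coth s - √(coth s ^ 2 - β) ≤ coth t - √(coth t ^ 2 - β) := by
  have ht := one_lt_coth_s9 (hs.trans_le hst)
  exact sub_sqrt_sq_sub_antitone hβ (by linarith) (by nlinarith) (coth_le_coth hs hst)

lemma lamS_mono_time {β T T' : ℝ} {k : ℕ} (hβ : 0 < β) (hβ1 : β ≤ 1) (hk : 1 ≤ k)
    (hT : 0 < T) (hTT' : T ≤ T') : lamS k β T ≤ lamS k β T' := by
  have hk0 : (0 : ℝ) < k := by exact_mod_cast hk
  exact mul_le_mul_of_nonneg_left
    (coth_sub_sqrt_mono hβ hβ1 (by positivity) (by gcongr)) (by positivity)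

lemma lamS_strictMono_index {β T : ℝ} {k k' : ℕ} (hβ : 0 < β) (hβ1 : β ≤ 1) (hk : 1 ≤ k)
    (hkk' : k < k') (hT : 0 < T) : lamS k β T < lamS k' β T := by
  have hk0 : (0 : ℝ) < k := by exact_mod_cast hk
  have hkk : (k : ℝ) < k' := by exact_mod_cast hkk'
  have hs : 0 < (k : ℝ) * T := by positivity
  refine mul_lt_mul (by gcongr) (coth_sub_sqrt_mono hβ hβ1 hs (by gcongr))
    (sub_sqrt_sq_sub_pos hβ (zero_lt_one.trans (one_lt_coth_s9 hs))) (by positivity)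

lemma muS_antitone_time {β T T' : ℝ} (l : ℕ) (hβ : 0 < β) (hT : 0 < T) (hTT' : T ≤ T') :
    muS l β T' ≤ muS l β T := by
  unfold muS
  split_ifs with hl
  · gcongr
  · have hl0 : (0 : ℝ) < l := by exact_mod_cast Nat.pos_of_ne_zero hl
    have hle : coth (l * T') ≤ coth (l * T) := coth_le_coth (by positivity) (by gcongr)
    have hpos : 0 ≤ coth (l * T') :=
      (zero_lt_one.trans (one_lt_coth_s9 (mul_pos hl0 (hT.trans_le hTT')))).le
    gcongr

theorem intersection_time_decreasing_in_k (β : ℝ) (hβ : 0 < β) (hβ1 : β ≤ 1)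
    (l k k' : ℕ) (hk : 1 ≤ k) (hkk' : k < k') (T T' : ℝ) (hT : 0 < T) (hT' : 0 < T')
    (h : lamS k β T = muS l β T) (h' : lamS k' β T' = muS l β T') :
    T' < T := by
  by_contra! hTT'
  have h1 := lamS_mono_time hβ hβ1 hk hT hTT'
  have h2 := lamS_strictMono_index hβ hβ1 hk hkk' hT'
  have h3 := muS_antitone_time l hβ hT hTT'
  linarith
end

section
/- For every real number a ≥ 1, the function t ↦ a·tanh(a·t)/tanh(t) is non-increasing on (0, ∞); in particular, for a ≥ 1 and 0 < t ≤ t', one has a·tanh(a·t')/tanh(t') ≤ a·tanh(a·t)/tanh(t) ≤ a². -/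
open Real

theorem Real.hasDerivAt_tanh (x : ℝ) : HasDerivAt Real.tanh (1 / Real.cosh x ^ 2) x := by
  have h := (Real.hasDerivAt_sinh x).div (Real.hasDerivAt_cosh x) (Real.cosh_pos x).ne'
  rw [← pow_two, ← pow_two, Real.cosh_sq_sub_sinh_sq] at h
  exact h.congr_of_eventuallyEq (.of_forall Real.tanh_eq_sinh_div_cosh)

theorem Real.tanh_pos {x : ℝ} (hx : 0 < x) : 0 < Real.tanh x := by
  rw [Real.tanh_eq_sinh_div_cosh]
  exact div_pos (Real.sinh_pos_iff.2 hx) (Real.cosh_pos x)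

theorem hasDerivAt_comp_const_mul {f : ℝ → ℝ} {f' a x : ℝ} (h : HasDerivAt f f' (a * x)) :
    HasDerivAt (fun t => f (a * t)) (f' * a) x :=
  h.comp x (by simpa using (hasDerivAt_id x).const_mul a)

theorem Real.cosh_le_cosh_mul {a x : ℝ} (ha : 1 ≤ a) (hx : 0 ≤ x) :
    Real.cosh x ≤ Real.cosh (a * x) := by
  rw [Real.cosh_le_cosh, abs_of_nonneg hx, abs_of_nonneg (by positivity)]
  exact le_mul_of_one_le_left hx ha

theorem Real.mul_sinh_le_sinh_mul {a x : ℝ} (ha : 1 ≤ a) (hx : 0 ≤ x) :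
    a * Real.sinh x ≤ Real.sinh (a * x) := by
  have hderiv (t : ℝ) : HasDerivAt (fun t => Real.sinh (a * t) - a * Real.sinh t)
      (Real.cosh (a * t) * a - a * Real.cosh t) t :=
    (hasDerivAt_comp_const_mul (Real.hasDerivAt_sinh _)).sub
      ((Real.hasDerivAt_sinh t).const_mul a)
  have hmono : MonotoneOn (fun t => Real.sinh (a * t) - a * Real.sinh t) (Set.Ici 0) := by
    refine monotoneOn_of_deriv_nonneg (convex_Ici 0)
      (fun t _ => (hderiv t).continuousAt.continuousWithinAt)
      (fun t _ => (hderiv t).differentiableAt.differentiableWithinAt) fun t ht => ?_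
    rw [interior_Ici] at ht
    rw [(hderiv t).deriv]
    nlinarith [Real.cosh_le_cosh_mul ha (le_of_lt ht)]
  simpa using hmono Set.self_mem_Ici hx hx

theorem Real.tanh_mul_le_mul_tanh {a x : ℝ} (ha : 1 ≤ a) (hx : 0 ≤ x) :
    Real.tanh (a * x) ≤ a * Real.tanh x := by
  have hderiv (t : ℝ) : HasDerivAt (fun t => a * Real.tanh t - Real.tanh (a * t))
      (a * (1 / Real.cosh t ^ 2) - 1 / Real.cosh (a * t) ^ 2 * a) t :=
    ((Real.hasDerivAt_tanh t).const_mul a).sub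
      (hasDerivAt_comp_const_mul (Real.hasDerivAt_tanh _))
  have hmono : MonotoneOn (fun t => a * Real.tanh t - Real.tanh (a * t)) (Set.Ici 0) := by
    refine monotoneOn_of_deriv_nonneg (convex_Ici 0)
      (fun t _ => (hderiv t).continuousAt.continuousWithinAt)
      (fun t _ => (hderiv t).differentiableAt.differentiableWithinAt) fun t ht => ?_
    rw [interior_Ici] at ht
    rw [(hderiv t).deriv]
    have hcosh : 1 / Real.cosh (a * t) ^ 2 ≤ 1 / Real.cosh t ^ 2 := by
      have := Real.cosh_pos t
      gcongr
      exact Real.cosh_le_cosh_mul ha (le_of_lt ht)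
    nlinarith
  simpa using hmono Set.self_mem_Ici hx hx

theorem Real.antitoneOn_mul_tanh_mul_div_tanh {a : ℝ} (ha : 1 ≤ a) :
    AntitoneOn (fun t => a * Real.tanh (a * t) / Real.tanh t) (Set.Ioi 0) := by
  have hderiv (t : ℝ) (ht : 0 < t) :=
    ((hasDerivAt_comp_const_mul (a := a) (Real.hasDerivAt_tanh (a * t))).const_mul a).div
      (Real.hasDerivAt_tanh t) (Real.tanh_pos ht).ne'
  refine antitoneOn_of_deriv_nonpos (convex_Ioi 0)
    (fun t ht => (hderiv t ht).continuousAt.continuousWithinAt)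
    (fun t ht => (hderiv t (interior_subset ht)).differentiableAt.differentiableWithinAt)
    fun t ht => ?_
  rw [interior_Ioi] at ht
  refine (hderiv t ht).deriv.trans_le (div_nonpos_of_nonpos_of_nonneg ?_ (sq_nonneg _))
  have hsinh := Real.mul_sinh_le_sinh_mul ha (mul_nonneg zero_le_two (le_of_lt ht))
  rw [show a * (2 * t) = 2 * (a * t) by ring, Real.sinh_two_mul, Real.sinh_two_mul] at hsinh
  have hc := Real.cosh_pos t
  have hca := Real.cosh_pos (a * t)
  rw [Real.tanh_eq_sinh_div_cosh, Real.tanh_eq_sinh_div_cosh]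
  have hnum : a * (1 / Real.cosh (a * t) ^ 2 * a) * (Real.sinh t / Real.cosh t) -
        a * (Real.sinh (a * t) / Real.cosh (a * t)) * (1 / Real.cosh t ^ 2) =
      a * (a * (Real.sinh t * Real.cosh t) - Real.sinh (a * t) * Real.cosh (a * t)) /
        (Real.cosh (a * t) ^ 2 * Real.cosh t ^ 2) := by
    field_simp
  rw [hnum]
  exact div_nonpos_of_nonpos_of_nonneg
    (mul_nonpos_of_nonneg_of_nonpos (by linarith) (by linarith)) (by positivity)

theorem tanh_ratio_antitone (a : ℝ) (ha : 1 ≤ a) :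
    AntitoneOn (fun t => a * Real.tanh (a * t) / Real.tanh t) (Set.Ioi 0) ∧
    ∀ t t' : ℝ, 0 < t → t ≤ t' →
      a * Real.tanh (a * t') / Real.tanh t' ≤ a * Real.tanh (a * t) / Real.tanh t ∧
      a * Real.tanh (a * t) / Real.tanh t ≤ a ^ 2 := by
  have hanti := Real.antitoneOn_mul_tanh_mul_div_tanh ha
  refine ⟨hanti, fun t t' ht htt' => ⟨hanti ht (ht.trans_le htt') htt', ?_⟩⟩
  rw [div_le_iff₀ (Real.tanh_pos ht), pow_two, mul_assoc]
  exact mul_le_mul_of_nonneg_left (Real.tanh_mul_le_mul_tanh ha ht.le) (by linarith)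
end
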